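/- Let S=(0,2), and for V_0>0 let λ_k(V_0) denote the k-th eigenvalue of −d²/dx² + V_0·χ_{(1,2)} on (0,2) with Dirichlet boundary conditions, and let μ_k = π²k² be the k-th Dirichlet eigenvalue of −d²/dx² on (0,1). Then there exists a constant C>0 (depending on k) such that |λ_k(V_0) − μ_k| ≤ C/√V_0 for all sufficiently large V_0. -/

import Mathlib

open Real Set MeasureTheory

/-- Rayleigh quotient of the Schrödinger operator `-d²/dx² + V₀·χ_{(1,2)}` on `(0,2)`. -/
noncomputable def rayleigh1d (V₀ : ℝ) (u : ℝ → ℝ) : ℝ :=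
  ((∫ x in Ioo (0:ℝ) 2, (deriv u x) ^ 2) + V₀ * ∫ x in Ioo (1:ℝ) 2, (u x) ^ 2) /
    ∫ x in Ioo (0:ℝ) 2, (u x) ^ 2

/-- `k`-th eigenvalue of `-d²/dx² + V₀·χ_{(1,2)}` on `(0,2)` with Dirichlet boundary
conditions, via the Courant–Fischer min-max formula over (a form core of) `H¹₀(0,2)`. -/
noncomputable def lamWell (V₀ : ℝ) (k : ℕ) : ℝ :=
  ⨅ Q : {Q : Submodule ℝ (ℝ → ℝ) //
      Module.finrank ℝ Q = k ∧ ∀ u ∈ Q, ContDiff ℝ 1 u ∧ tsupport u ⊆ Ioo (0:ℝ) 2},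
    ⨆ u : {u : (Q : Submodule ℝ (ℝ → ℝ)) // (u : ℝ → ℝ) ≠ 0},
      rayleigh1d V₀ ((u : (Q : Submodule ℝ (ℝ → ℝ))) : ℝ → ℝ)

theorem sq_integral_le_of_left_zero {u : ℝ → ℝ} (hu : ContDiff ℝ 1 u) {p q ω : ℝ} (hpq : p ≤ q)
    (hω : 0 < ω) (hlt : ω * (q - p) < π) (hp : u p = 0) :
    ω ^ 2 * ∫ x in p..q, u x ^ 2 ≤
      (∫ x in p..q, deriv u x ^ 2) + ω * tan (ω * (q - p) / 2) * u q ^ 2 := by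
  set m := (p + q) / 2 with hm
  have hcu : Continuous u := hu.continuous
  have hcd : Continuous (deriv u) := hu.continuous_deriv le_rfl
  have hcos : ∀ x ∈ Icc p q, cos (ω * (x - m)) ≠ 0 := by
    intro x hx
    refine (cos_pos_of_mem_Ioo ⟨?_, ?_⟩).ne' <;> nlinarith [hx.1, hx.2]
  have htan : ContinuousOn (fun x => tan (ω * (x - m))) (Icc p q) :=
    fun x hx => ((continuousAt_tan.2 (hcos x hx)).comp
      (f := fun x => ω * (x - m)) (by fun_prop)).continuousWithinAt
  let h : ℝ → ℝ := fun x => ω * tan (ω * (x - m))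
  have hh : ContinuousOn h (Icc p q) := htan.const_smul ω
  let F' : ℝ → ℝ := fun x => (ω ^ 2 + h x ^ 2) * u x ^ 2 + h x * (2 * u x * deriv u x)
  have hF : ∀ x ∈ uIcc p q, HasDerivAt (fun x => h x * u x ^ 2) (F' x) x := by
    intro x hx
    rw [uIcc_of_le hpq] at hx
    have hc := hcos x hx
    have h1 : HasDerivAt (fun x => ω * (x - m)) ω x := by
      simpa using ((hasDerivAt_id x).sub_const m).const_mul ω
    have h2 := ((hasDerivAt_tan hc).comp x h1).const_mul ω
    have h3 := ((hu.differentiable one_ne_zero x).hasDerivAt).pow 2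
    refine (h2.mul h3).congr_deriv ?_
    simp only [F', h, Function.comp, Pi.pow_apply]
    have h4 := sin_sq_add_cos_sq (ω * (x - m))
    rw [tan_eq_sin_div_cos]
    field_simp
    push_cast
    linear_combination (-(ω * u x ^ 2)) * h4
  have hF'c : ContinuousOn F' (Icc p q) := by
    have := hcu.continuousOn (s := Icc p q)
    have := hcd.continuousOn (s := Icc p q)
    fun_prop
  have hF'i : IntervalIntegrable F' volume p q :=
    (by rwa [uIcc_of_le hpq] : ContinuousOn F' (uIcc p q)).intervalIntegrable
  have hi1 : IntervalIntegrable (fun x => deriv u x ^ 2) volume p q :=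
    (hcd.pow 2).intervalIntegrable _ _
  have hi2 : IntervalIntegrable (fun x => ω ^ 2 * u x ^ 2) volume p q :=
    (by fun_prop : Continuous fun x => ω ^ 2 * u x ^ 2).intervalIntegrable _ _
  have hftc := intervalIntegral.integral_eq_sub_of_hasDerivAt hF hF'i
  have hmono := intervalIntegral.integral_mono_on hpq hi2 (hi1.add hF'i) (fun x _ => by
    simp only [F']
    nlinarith [sq_nonneg (deriv u x + h x * u x)])
  rw [intervalIntegral.integral_add hi1 hF'i, hftc, intervalIntegral.integral_const_mul] at hmono
  have hmq : ω * (q - m) = ω * (q - p) / 2 := by rw [hm]; ring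
  simpa [h, hp, hmq] using hmono

theorem mul_sq_le_of_right_zero {u : ℝ → ℝ} (hu : ContDiff ℝ 1 u) {p q : ℝ} (hpq : p ≤ q)
    (W : ℝ) (hq : u q = 0) :
    W * u p ^ 2 ≤ (∫ x in p..q, deriv u x ^ 2) + W ^ 2 * ∫ x in p..q, u x ^ 2 := by
  have hcu : Continuous u := hu.continuous
  have hcd : Continuous (deriv u) := hu.continuous_deriv le_rfl
  have hF : ∀ x ∈ uIcc p q, HasDerivAt (fun x => -(W * u x ^ 2))
      (-(W * (2 * u x * deriv u x))) x := by
    intro x _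
    simpa using ((((hu.differentiable one_ne_zero x).hasDerivAt).fun_pow 2).const_mul W).fun_neg
  have hftc := intervalIntegral.integral_eq_sub_of_hasDerivAt hF
    ((by fun_prop : Continuous fun x => -(W * (2 * u x * deriv u x))).intervalIntegrable _ _)
  have hmono := intervalIntegral.integral_mono_on (μ := volume)
    (f := fun x => -(W * (2 * u x * deriv u x)))
    (g := fun x => deriv u x ^ 2 + W ^ 2 * u x ^ 2) hpq
    ((by fun_prop : Continuous _).intervalIntegrable _ _)
    ((by fun_prop : Continuous _).intervalIntegrable _ _)
    (fun x _ => by nlinarith [sq_nonneg (deriv u x + W * u x)])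
  rw [hftc, intervalIntegral.integral_add
    ((by fun_prop : Continuous _).intervalIntegrable _ _)
    ((by fun_prop : Continuous _).intervalIntegrable _ _),
    intervalIntegral.integral_const_mul] at hmono
  simpa [hq] using hmono

theorem sq_integral_unit_le {u : ℝ → ℝ} (hu : ContDiff ℝ 1 u) {k : ℕ} (hk : 1 ≤ k)
    (hz : ∀ j < k, u (j / k) = 0) {ω : ℝ} (hω : 0 < ω) (hlt : ω < k * π) :
    ω ^ 2 * ∫ x in (0:ℝ)..1, u x ^ 2 ≤
      (∫ x in (0:ℝ)..1, deriv u x ^ 2) + ω * tan (ω / (2 * k)) * u 1 ^ 2 := by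
  have hk0 : (0:ℝ) < k := by exact_mod_cast hk
  have hcu : Continuous u := hu.continuous
  have hcd : Continuous (deriv u) := hu.continuous_deriv le_rfl
  have hsum : ∀ f : ℝ → ℝ, Continuous f → ∑ j ∈ Finset.range k,
      ∫ x in ((j:ℝ) / k)..((j + 1 : ℕ) : ℝ) / k, f x = ∫ x in (0:ℝ)..1, f x := by
    intro f hf
    have := intervalIntegral.sum_integral_adjacent_intervals (f := f) (μ := volume) (n := k)
      (a := fun j : ℕ => (j:ℝ) / k) (fun j _ => hf.intervalIntegrable _ _)
    simpa [hk0.ne'] using this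
  have hpiece : ∀ j ∈ Finset.range k,
      ω ^ 2 * ∫ x in ((j:ℝ) / k)..((j + 1 : ℕ) : ℝ) / k, u x ^ 2 ≤
      (∫ x in ((j:ℝ) / k)..((j + 1 : ℕ) : ℝ) / k, deriv u x ^ 2) +
        ω * tan (ω / (2 * k)) * u (((j + 1 : ℕ) : ℝ) / k) ^ 2 := by
    intro j hj
    have hlen : ((j + 1 : ℕ) : ℝ) / k - j / k = 1 / k := by push_cast; ring
    have := sq_integral_le_of_left_zero hu (p := (j:ℝ) / k) (q := ((j + 1 : ℕ) : ℝ) / k)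
      (by gcongr; simp) hω (by rw [hlen, mul_one_div, div_lt_iff₀ hk0]; linarith)
      (hz j (Finset.mem_range.1 hj))
    rw [hlen, show ω * (1 / k) / 2 = ω / (2 * k) by field_simp] at this
    exact this
  have hbd : ∑ j ∈ Finset.range k, ω * tan (ω / (2 * k)) * u (((j + 1 : ℕ) : ℝ) / k) ^ 2 =
      ω * tan (ω / (2 * k)) * u 1 ^ 2 := by
    rw [Finset.sum_eq_single (k - 1)]
    · rw [Nat.sub_add_cancel hk, div_self hk0.ne']
    · intro j hj hne
      rw [hz (j + 1) (by have := Finset.mem_range.1 hj; omega)]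
      simp
    · intro h; simp at h; omega
  have := Finset.sum_le_sum hpiece
  rwa [← Finset.mul_sum, Finset.sum_add_distrib, hbd, hsum _ (by fun_prop),
    hsum _ (by fun_prop)] at this

theorem setIntegral_Ioo_eq_intervalIntegral (f : ℝ → ℝ) {a b : ℝ} (h : a ≤ b) :
    ∫ x in Ioo a b, f x = ∫ x in a..b, f x := by
  rw [intervalIntegral.integral_of_le h, integral_Ioc_eq_integral_Ioo]

theorem rayleigh1d_eq (V : ℝ) (u : ℝ → ℝ) :
    rayleigh1d V u = ((∫ x in (0:ℝ)..2, deriv u x ^ 2) + V * ∫ x in (1:ℝ)..2, u x ^ 2) /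
      ∫ x in (0:ℝ)..2, u x ^ 2 := by
  rw [rayleigh1d, setIntegral_Ioo_eq_intervalIntegral _ (by norm_num),
    setIntegral_Ioo_eq_intervalIntegral _ (by norm_num),
    setIntegral_Ioo_eq_intervalIntegral _ (by norm_num)]

theorem sq_integral_pos {u : ℝ → ℝ} (hu : Continuous u) (hs : tsupport u ⊆ Ioo (0:ℝ) 2)
    (hne : u ≠ 0) : 0 < ∫ x in (0:ℝ)..2, u x ^ 2 := by
  obtain ⟨c, hc⟩ := Function.ne_iff.1 hne
  have hc2 := hs (subset_tsupport u hc)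
  exact intervalIntegral.integral_pos (by norm_num) (hu.pow 2).continuousOn
    (fun x _ => sq_nonneg _) ⟨c, Ioo_subset_Icc_self hc2, by
      have : u c ≠ 0 := hc
      positivity⟩

theorem le_rayleigh1d {u : ℝ → ℝ} (hu : ContDiff ℝ 1 u) (hs : tsupport u ⊆ Ioo (0:ℝ) 2)
    (hne : u ≠ 0) {k : ℕ} (hk : 1 ≤ k) (hz : ∀ j < k, u (j / k) = 0) {V : ℝ}
    (hV : (8 * k * π) ^ 2 ≤ V) :
    π ^ 2 * (k : ℝ) ^ 2 - 8 * k ^ 3 * π ^ 2 / √V ≤ rayleigh1d V u := by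
  have hk0 : (0:ℝ) < k := by exact_mod_cast hk
  have hπ := pi_pos
  have hcu : Continuous u := hu.continuous
  have hcd : Continuous (deriv u) := hu.continuous_deriv le_rfl
  have hD := sq_integral_pos hcu hs hne
  set r := √V with hr
  have hrl : 8 * k * π ≤ r := Real.le_sqrt_of_sq_le hV
  have hr0 : 0 < r := lt_of_lt_of_le (by positivity) hrl
  have hrV : V = r ^ 2 := (Real.sq_sqrt (le_trans (by positivity) hV)).symm
  set η := 4 * k ^ 2 * π / r with hη
  have hη0 : 0 < η := by positivity
  have hηlt : η < k * π := by
    rw [hη, div_lt_iff₀ hr0]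
    nlinarith [pi_gt_three, mul_pos hk0 hπ, mul_pos hk0 (mul_pos hk0 hπ)]
  have h1 := sq_integral_unit_le hu hk hz (ω := k * π - η) (by linarith) (by linarith)
  have htan : (k * π - η) * tan ((k * π - η) / (2 * k)) ≤ r / 2 := by
    have hy : (k * π - η) / (2 * k) = π / 2 - η / (2 * k) := by field_simp
    have hy0 : 0 < η / (2 * k) := by positivity
    have hylt : η / (2 * k) < π / 2 := by
      rw [div_lt_iff₀ (by positivity)]; linarith
    rw [hy, tan_pi_div_two_sub]
    calc (k * π - η) * (tan (η / (2 * k)))⁻¹ ≤ (k * π) * (η / (2 * k))⁻¹ := by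
          gcongr
          · exact inv_nonneg.2 (hy0.le.trans (le_tan hy0.le hylt))
          · linarith
          · exact le_tan hy0.le hylt
      _ = r / 2 := by rw [hη]; field_simp; norm_num
  have hu2 : u 2 = 0 := image_eq_zero_of_notMem_tsupport fun h => by simpa using (hs h).2
  have h2 := mul_sq_le_of_right_zero hu (p := 1) (q := 2) (by norm_num) (r / 2) hu2
  have hs1 := intervalIntegral.integral_add_adjacent_intervals (μ := volume)
    ((hcd.pow 2).intervalIntegrable 0 1) ((hcd.pow 2).intervalIntegrable 1 2)
  have hs2 := intervalIntegral.integral_add_adjacent_intervals (μ := volume)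
    ((hcu.pow 2).intervalIntegrable 0 1) ((hcu.pow 2).intervalIntegrable 1 2)
  simp only [Pi.pow_apply] at hs1 hs2
  have hn : 0 ≤ ∫ x in (1:ℝ)..2, u x ^ 2 :=
    intervalIntegral.integral_nonneg (by norm_num) fun x _ => sq_nonneg _
  have h3 : (k * π - η) * tan ((k * π - η) / (2 * k)) * u 1 ^ 2 ≤ r / 2 * u 1 ^ 2 := by gcongr
  have h4 : (k * π - η) ^ 2 ≤ 3 / 4 * r ^ 2 := by
    have : (k * π - η) ^ 2 ≤ (8 * k * π) ^ 2 / 64 := by nlinarith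
    nlinarith
  have h5 : (k * π - η) ^ 2 * (∫ x in (1:ℝ)..2, u x ^ 2) ≤
      3 / 4 * r ^ 2 * ∫ x in (1:ℝ)..2, u x ^ 2 := by gcongr
  have h6 : π ^ 2 * (k : ℝ) ^ 2 - 8 * k ^ 3 * π ^ 2 / r ≤ (k * π - η) ^ 2 := by
    have : 8 * k ^ 3 * π ^ 2 / r = 2 * (k * π) * η := by rw [hη]; ring
    nlinarith
  refine h6.trans ?_
  rw [rayleigh1d_eq, le_div_iff₀ hD, ← hs1, ← hs2, hrV]
  nlinarith

theorem hasDerivAt_max_zero_sq (t : ℝ) :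
    HasDerivAt (fun t : ℝ => max t 0 ^ 2) (2 * max t 0) t := by
  rcases lt_trichotomy t 0 with h | rfl | h
  · rw [max_eq_right h.le, mul_zero]
    refine (hasDerivAt_const t (0:ℝ)).congr_of_eventuallyEq ?_
    filter_upwards [Iio_mem_nhds h] with y hy
    simp [max_eq_right (mem_Iio.1 hy).le]
  · rw [max_self, mul_zero, ← hasDerivWithinAt_univ, ← Iic_union_Ici (a := (0:ℝ))]
    refine HasDerivWithinAt.union ?_ ?_
    · refine (hasDerivWithinAt_const 0 _ (0:ℝ)).congr (fun y hy => ?_) (by simp)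
      simp [max_eq_right (mem_Iic.1 hy)]
    · have h2 : HasDerivWithinAt (fun t : ℝ => t ^ 2) 0 (Ici 0) 0 := by
        simpa using (hasDerivAt_pow 2 (0:ℝ)).hasDerivWithinAt (s := Ici 0)
      refine h2.congr (fun y hy => ?_) (by simp)
      simp [max_eq_left (mem_Ici.1 hy)]
  · rw [max_eq_left h.le]
    have h2 : HasDerivAt (fun t : ℝ => t ^ 2) (2 * t) t := by simpa using hasDerivAt_pow 2 t
    refine h2.congr_of_eventuallyEq ?_
    filter_upwards [Ioi_mem_nhds h] with y hy
    simp [max_eq_left (mem_Ioi.1 hy).le]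

theorem contDiff_max_zero_sq : ContDiff ℝ 1 (fun t : ℝ => max t 0 ^ 2) := by
  refine contDiff_one_iff_deriv.2 ⟨fun t => (hasDerivAt_max_zero_sq t).differentiableAt, ?_⟩
  rw [funext fun t => (hasDerivAt_max_zero_sq t).deriv]
  fun_prop

theorem exists_contDiff_contraction_eq_zero {δ : ℝ} (hδ : 0 < δ) :
    ∃ φ : ℝ → ℝ, ContDiff ℝ 1 φ ∧ (∀ t, t ≤ δ → φ t = 0) ∧ (∀ t, deriv φ t ^ 2 ≤ 1) ∧
      (∀ t, 0 ≤ φ t) ∧ ∀ t, t - 2 * δ ≤ φ t := by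
  have hpos : ∀ t : ℝ, 0 < max (t - δ) 0 ^ 2 + δ ^ 2 := fun t => by positivity
  have hd : ∀ t, HasDerivAt (fun t => √(max (t - δ) 0 ^ 2 + δ ^ 2) - δ)
      (2 * max (t - δ) 0 / (2 * √(max (t - δ) 0 ^ 2 + δ ^ 2))) t := fun t => by
    have h1 := (hasDerivAt_max_zero_sq (t - δ)).comp_sub_const t δ
    exact ((h1.add_const (δ ^ 2)).sqrt (hpos t).ne').sub_const δ
  refine ⟨fun t => √(max (t - δ) 0 ^ 2 + δ ^ 2) - δ, ?_, ?_, ?_, ?_, ?_⟩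
  · have h1 : ContDiff ℝ 1 fun t : ℝ => max (t - δ) 0 ^ 2 :=
      contDiff_max_zero_sq.comp (contDiff_id.sub contDiff_const)
    exact ((h1.add contDiff_const).sqrt fun t => (hpos t).ne').sub contDiff_const
  · intro t ht
    simp [max_eq_right (sub_nonpos.2 ht), Real.sqrt_sq hδ.le]
  · intro t
    rw [(hd t).deriv, mul_div_mul_left _ _ two_ne_zero, div_pow, Real.sq_sqrt (hpos t).le,
      div_le_one (hpos t)]
    nlinarith
  · intro t
    exact sub_nonneg.2 (Real.le_sqrt_of_sq_le (by nlinarith [sq_nonneg (max (t - δ) 0)]))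
  · intro t
    have : t - δ ≤ √(max (t - δ) 0 ^ 2 + δ ^ 2) :=
      (le_max_left _ _).trans (Real.le_sqrt_of_sq_le (by nlinarith [sq_nonneg δ]))
    linarith

theorem integral_eq_intervalIntegral_of_support {f : ℝ → ℝ} {a b : ℝ} (h : a ≤ b)
    (hf : ∀ x, f x ≠ 0 → x ∈ Ioo a b) : ∫ x, f x = ∫ x in a..b, f x := by
  rw [← setIntegral_Ioo_eq_intervalIntegral _ h]
  exact (setIntegral_eq_integral_of_forall_compl_eq_zero
    fun x hx => by_contra fun h => hx (hf x h)).symm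

theorem exists_almost_minimizer {ε : ℝ} (hε : 0 < ε) :
    ∃ v : ℝ → ℝ, ContDiff ℝ 1 v ∧ (∃ a > 0, ∀ x, v x ≠ 0 → x ∈ Icc a (π - a)) ∧
      0 < ∫ x, v x ^ 2 ∧ ∫ x, deriv v x ^ 2 ≤ (1 + ε) * ∫ x, v x ^ 2 := by
  have hπ := pi_pos
  set δ := ε / (8 * (1 + ε)) with hδ
  have hδ0 : 0 < δ := by positivity
  have hδe : (1 + ε) * (1 - 8 * δ) = 1 := by rw [hδ]; field_simp; ring
  obtain ⟨φ, hφ, hφ0, hφ1, hφn, hφl⟩ := exists_contDiff_contraction_eq_zero hδ0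
  let v : ℝ → ℝ := fun x => if x ∈ Ioo 0 π then φ (sin x) else 0
  have hsupp : ∀ x, v x ≠ 0 → x ∈ Icc δ (π - δ) := by
    intro x hx
    by_cases hm : x ∈ Ioo 0 π
    · simp only [v, if_pos hm] at hx
      have hlt : δ < sin x := not_le.1 fun h => hx (hφ0 _ h)
      have h1 := sin_lt hm.1
      have h2 := sin_lt (sub_pos.2 hm.2)
      rw [sin_pi_sub] at h2
      exact ⟨by linarith, by linarith⟩
    · exact absurd (if_neg hm) hx
  have hin : ∀ x ∈ Ioo 0 π, v =ᶠ[nhds x] fun y => φ (sin y) := fun x hx => by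
    filter_upwards [isOpen_Ioo.mem_nhds hx] with y hy
    simp only [v, if_pos hy]
  have hv : ContDiff ℝ 1 v := by
    refine contDiff_iff_contDiffAt.2 fun x => ?_
    by_cases hm : x ∈ Ioo 0 π
    · exact (hφ.comp contDiff_sin).contDiffAt.congr_of_eventuallyEq (hin x hm)
    · have hx : x ∈ (Icc δ (π - δ))ᶜ := fun h =>
        hm ⟨by linarith [h.1], by linarith [h.2]⟩
      refine (contDiffAt_const (c := (0:ℝ))).congr_of_eventuallyEq ?_
      filter_upwards [isClosed_Icc.isOpen_compl.mem_nhds hx] with y hy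
      exact by_contra fun h => hy (hsupp y h)
  have hsub : Icc δ (π - δ) ⊆ Ioo 0 π := fun x h => ⟨by linarith [h.1], by linarith [h.2]⟩
  have hts : tsupport v ⊆ Icc δ (π - δ) := closure_minimal hsupp isClosed_Icc
  have hcv := hv.continuous
  have hcd : Continuous (deriv v) := hv.continuous_deriv le_rfl
  have hI1 : ∫ x, v x ^ 2 = ∫ x in (0:ℝ)..π, v x ^ 2 :=
    integral_eq_intervalIntegral_of_support hπ.le fun x hx =>
      hsub (hsupp x fun h => hx (by simp [h]))
  have hI2 : ∫ x, deriv v x ^ 2 = ∫ x in (0:ℝ)..π, deriv v x ^ 2 :=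
    integral_eq_intervalIntegral_of_support hπ.le fun x hx =>
      hsub (hts (support_deriv_subset fun h => hx (by simp [h])))
  have hD : ∫ x, deriv v x ^ 2 ≤ π / 2 := by
    have hc : ∫ x in (0:ℝ)..π, cos x ^ 2 = π / 2 := by rw [integral_cos_sq]; simp
    rw [hI2, ← hc, intervalIntegral.integral_of_le hπ.le, intervalIntegral.integral_of_le hπ.le,
      integral_Ioc_eq_integral_Ioo, integral_Ioc_eq_integral_Ioo]
    refine setIntegral_mono_on ?_ ?_ measurableSet_Ioo fun x hx => ?_
    · exact (hcd.pow 2).continuousOn.integrableOn_Icc.mono_set Ioo_subset_Icc_self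
    · exact (continuous_cos.pow 2).continuousOn.integrableOn_Icc.mono_set Ioo_subset_Icc_self
    · have h1 := ((hφ.differentiable one_ne_zero (sin x)).hasDerivAt.comp x (hasDerivAt_sin x))
      rw [(h1.congr_of_eventuallyEq (hin x hx)).deriv, mul_pow]
      exact mul_le_of_le_one_left (sq_nonneg _) (hφ1 _)
  have hN : π / 2 * (1 - 8 * δ) ≤ ∫ x, v x ^ 2 := by
    have hc : ∫ x in (0:ℝ)..π, (sin x ^ 2 - 4 * δ) = π / 2 * (1 - 8 * δ) := by
      rw [intervalIntegral.integral_sub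
        ((by fun_prop : Continuous fun x => sin x ^ 2).intervalIntegrable _ _)
        intervalIntegrable_const, integral_sin_sq, intervalIntegral.integral_const]
      simp
      ring
    rw [hI1, ← hc, intervalIntegral.integral_of_le hπ.le, intervalIntegral.integral_of_le hπ.le,
      integral_Ioc_eq_integral_Ioo, integral_Ioc_eq_integral_Ioo]
    refine setIntegral_mono_on ?_ ?_ measurableSet_Ioo fun x hx => ?_
    · exact (by fun_prop : Continuous fun x => sin x ^ 2 - 4 * δ).continuousOn.integrableOn_Icc
        |>.mono_set Ioo_subset_Icc_self
    · exact (hcv.pow 2).continuousOn.integrableOn_Icc.mono_set Ioo_subset_Icc_self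
    · simp only [v, if_pos hx]
      have h0 := sin_pos_of_mem_Ioo hx
      have h1 := sin_le_one x
      have h2 := hφl (sin x)
      have h3 := hφn (sin x)
      rcases le_total (2 * δ) (sin x) with h | h <;> nlinarith
  refine ⟨v, hv, ⟨δ, hδ0, hsupp⟩, ?_, ?_⟩
  · refine lt_of_lt_of_le ?_ hN
    have : 0 < 1 - 8 * δ := by
      by_contra! h
      nlinarith
    positivity
  · nlinarith

theorem sq_sum_translates {g : ℝ → ℝ} (hg : ∀ x, g x ≠ 0 → x ∈ Ioo 0 π) {k : ℕ}
    (c : Fin k → ℝ) (y : ℝ) :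
    (∑ j, c j * g (y - j * π)) ^ 2 = ∑ j, c j ^ 2 * g (y - j * π) ^ 2 := by
  by_cases h : ∃ i : Fin k, g (y - i * π) ≠ 0
  · obtain ⟨i, hi⟩ := h
    have hz : ∀ j, j ≠ i → g (y - j * π) = 0 := by
      intro j hj
      by_contra hne
      refine hj (Fin.ext ?_)
      have h1 := hg _ hi
      have h2 := hg _ hne
      have hπ := pi_pos
      have h3 : (i : ℝ) < j + 1 := by
        refine lt_of_mul_lt_mul_right ?_ hπ.le
        linarith [h1.1, h1.2, h2.1, h2.2]
      have h4 : (j : ℝ) < i + 1 := by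
        refine lt_of_mul_lt_mul_right ?_ hπ.le
        linarith [h1.1, h1.2, h2.1, h2.2]
      norm_cast at h3 h4
      omega
    rw [Finset.sum_eq_single i (fun j _ hj => by rw [hz j hj, mul_zero]) (by simp),
      Finset.sum_eq_single i (fun j _ hj => by rw [hz j hj]; ring) (by simp), mul_pow]
  · push Not at h
    simp [h]

theorem integral_sq_sum_translates {g : ℝ → ℝ} (hc : Continuous g)
    (hg : ∀ x, g x ≠ 0 → x ∈ Ioo 0 π) {k : ℕ} (c : Fin k → ℝ) {s : ℝ} (hs : 0 < s) :
    ∫ x, (∑ j, c j * g (s * x - j * π)) ^ 2 = (∑ j, c j ^ 2) * (s⁻¹ * ∫ x, g x ^ 2) := by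
  have hcs : HasCompactSupport fun x => g x ^ 2 :=
    HasCompactSupport.intro isCompact_Icc (K := Icc 0 π) fun x hx => by
      have : g x = 0 := by_contra fun h => hx (Ioo_subset_Icc_self (hg x h))
      simp [this]
  have hi : Integrable fun x => g x ^ 2 := (hc.pow 2).integrable_of_hasCompactSupport hcs
  simp only [sq_sum_translates hg]
  rw [integral_finsetSum, Finset.sum_mul]
  · refine Finset.sum_congr rfl fun j _ => ?_
    rw [integral_const_mul, Measure.integral_comp_mul_left (fun y => g (y - j * π) ^ 2) s,
      integral_sub_right_eq_self (fun y => g y ^ 2), abs_of_pos (inv_pos.2 hs), smul_eq_mul]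
  · intro j _
    exact ((hi.comp_sub_right (j * π)).comp_mul_left' hs.ne').const_mul _

theorem exists_subspace_rayleigh1d_le {k : ℕ} (hk : 1 ≤ k) {ε : ℝ} (hε : 0 < ε) :
    ∃ Q : Submodule ℝ (ℝ → ℝ), (Module.finrank ℝ Q = k ∧
      ∀ u ∈ Q, ContDiff ℝ 1 u ∧ tsupport u ⊆ Ioo (0:ℝ) 2) ∧
      ∀ u ∈ Q, u ≠ 0 → ∀ V, rayleigh1d V u ≤ π ^ 2 * (k : ℝ) ^ 2 * (1 + ε) := by
  have hk0 : (0:ℝ) < k := by exact_mod_cast hk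
  have hπ := pi_pos
  obtain ⟨v, hv, ⟨a, ha, hsupp⟩, hN, hR⟩ := exists_almost_minimizer hε
  have hsub : Icc a (π - a) ⊆ Ioo 0 π := fun x h => ⟨by linarith [h.1], by linarith [h.2]⟩
  have hts : tsupport v ⊆ Icc a (π - a) := closure_minimal hsupp isClosed_Icc
  have hs0 : 0 < k * π := by positivity
  let T : (Fin k → ℝ) →ₗ[ℝ] (ℝ → ℝ) :=
    { toFun := fun c x => ∑ j, c j * v (k * π * x - j * π)
      map_add' := fun c d => by ext x; simp [add_mul, Finset.sum_add_distrib]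
      map_smul' := fun r c => by ext x; simp [Finset.mul_sum, mul_assoc] }
  have hT : ∀ c x, T c x = ∑ j, c j * v (k * π * x - j * π) := fun _ _ => rfl
  have hI1 : ∀ c, ∫ x, T c x ^ 2 = (∑ j, c j ^ 2) * ((k * π)⁻¹ * ∫ x, v x ^ 2) := fun c =>
    integral_sq_sum_translates hv.continuous (fun x hx => hsub (hsupp x hx)) c hs0
  have hdT : ∀ c x, deriv (T c) x = k * π * ∑ j, c j * deriv v (k * π * x - j * π) := by
    intro c x
    refine HasDerivAt.deriv ?_
    rw [Finset.mul_sum]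
    refine HasDerivAt.fun_sum (u := Finset.univ)
      (A := fun (j : Fin k) x => c j * v (k * π * x - j * π))
      (A' := fun j => k * π * (c j * deriv v (k * π * x - j * π))) fun j _ => ?_
    have h1 : HasDerivAt (fun x => k * π * x - j * π) (k * π) x := by
      simpa using ((hasDerivAt_id x).const_mul (k * π)).sub_const (j * π)
    exact (((hv.differentiable one_ne_zero _).hasDerivAt.comp x h1).const_mul (c j)).congr_deriv
      (by ring)
  have hI2 : ∀ c, ∫ x, deriv (T c) x ^ 2 =
      (k * π) ^ 2 * ((∑ j, c j ^ 2) * ((k * π)⁻¹ * ∫ x, deriv v x ^ 2)) := by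
    intro c
    simp only [hdT, mul_pow (k * π)]
    rw [integral_const_mul, integral_sq_sum_translates (hv.continuous_deriv le_rfl)
      (fun x hx => hsub (hts (support_deriv_subset (f := v) hx))) c hs0]
  have hTsupp : ∀ c x, T c x ≠ 0 → x ∈ Icc (a / (k * π)) 1 := by
    intro c x hx
    obtain ⟨j, -, hj⟩ := Finset.exists_ne_zero_of_sum_ne_zero
      (s := Finset.univ) (f := fun j : Fin k => c j * v (k * π * x - j * π)) hx
    have h1 := hsupp _ (right_ne_zero_of_mul hj)
    have h2 : ((j : ℕ) : ℝ) + 1 ≤ k := by exact_mod_cast j.2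
    have h3 : (0:ℝ) ≤ (j : ℕ) * π := by positivity
    have h4 : (((j : ℕ) : ℝ) + 1) * π ≤ k * π := by gcongr
    constructor
    · rw [div_le_iff₀ hs0]; linarith [h1.1]
    · refine le_of_mul_le_mul_left ?_ hs0
      linarith [h1.2]
  have hTts : ∀ c, tsupport (T c) ⊆ Icc (a / (k * π)) 1 := fun c =>
    closure_minimal (hTsupp c) isClosed_Icc
  have hap : 0 < a / (k * π) := by positivity
  have hsub2 : Icc (a / (k * π)) 1 ⊆ Ioo (0:ℝ) 2 := fun x h =>
    ⟨lt_of_lt_of_le hap h.1, by linarith [h.2]⟩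
  have hTinj : Function.Injective T := by
    rw [← LinearMap.ker_eq_bot, LinearMap.ker_eq_bot']
    intro c hc
    have h0 := hI1 c
    simp only [hc, Pi.zero_apply, ne_eq, OfNat.ofNat_ne_zero, not_false_eq_true, zero_pow,
      integral_zero] at h0
    have h1 : ∑ j, c j ^ 2 = 0 :=
      (mul_eq_zero.1 h0.symm).resolve_right (by positivity)
    funext j
    have := (Finset.sum_eq_zero_iff_of_nonneg fun j _ => sq_nonneg (c j)).1 h1 j (Finset.mem_univ j)
    simpa using this
  refine ⟨LinearMap.range T, ⟨?_, ?_⟩, ?_⟩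
  · rw [LinearMap.finrank_range_of_inj hTinj, Module.finrank_fin_fun]
  · rintro _ ⟨c, rfl⟩
    refine ⟨?_, (hTts c).trans hsub2⟩
    have : ContDiff ℝ 1 fun x => ∑ j : Fin k, c j * v (k * π * x - j * π) :=
      ContDiff.sum fun j _ => contDiff_const.mul
        (hv.comp ((contDiff_const.mul contDiff_id).sub contDiff_const))
    exact this
  · rintro _ ⟨c, rfl⟩ hne V
    have hcv : 0 < ∑ j, c j ^ 2 := by
      refine (Finset.sum_nonneg fun j _ => sq_nonneg (c j)).lt_of_ne' fun h => hne ?_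
      have : c = 0 := funext fun j => by
        simpa using (Finset.sum_eq_zero_iff_of_nonneg fun j _ => sq_nonneg (c j)).1 h j
          (Finset.mem_univ j)
      rw [this, map_zero]
    have hJ1 : ∫ x in Ioo (0:ℝ) 2, T c x ^ 2 = ∫ x, T c x ^ 2 :=
      setIntegral_eq_integral_of_forall_compl_eq_zero fun x hx => by
        have : T c x = 0 := by_contra fun h => hx (hsub2 (hTsupp c x h))
        simp [this]
    have hJ2 : ∫ x in Ioo (0:ℝ) 2, deriv (T c) x ^ 2 = ∫ x, deriv (T c) x ^ 2 :=
      setIntegral_eq_integral_of_forall_compl_eq_zero fun x hx => by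
        have : deriv (T c) x = 0 :=
          by_contra fun h => hx (hsub2 (hTts c (support_deriv_subset h)))
        simp [this]
    have hJ3 : ∫ x in Ioo (1:ℝ) 2, T c x ^ 2 = 0 :=
      setIntegral_eq_zero_of_forall_eq_zero fun x hx => by
        have : T c x = 0 := by_contra fun h => not_lt.2 (hTsupp c x h).2 hx.1
        simp [this]
    rw [rayleigh1d, hJ1, hJ2, hJ3, hI1, hI2, div_le_iff₀ (by positivity)]
    calc _ = (k * π) ^ 2 * (∑ j, c j ^ 2) * (k * π)⁻¹ * ∫ x, deriv v x ^ 2 := by ring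
      _ ≤ (k * π) ^ 2 * (∑ j, c j ^ 2) * (k * π)⁻¹ * ((1 + ε) * ∫ x, v x ^ 2) := by gcongr
      _ = _ := by ring

theorem rayleigh1d_smul (V : ℝ) {t : ℝ} (ht : t ≠ 0) (u : ℝ → ℝ) :
    rayleigh1d V (t • u) = rayleigh1d V u := by
  have hd : ∀ x, deriv (t • u) x = t * deriv u x := fun x => deriv_const_mul_field t
  have ht2 : t ^ 2 ≠ 0 := by positivity
  simp only [rayleigh1d, hd, Pi.smul_apply, smul_eq_mul, mul_pow, integral_const_mul]
  rw [mul_left_comm, ← mul_add, mul_div_mul_left _ _ ht2]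

theorem bddAbove_rayleigh1d (V : ℝ) (Q : Submodule ℝ (ℝ → ℝ)) [FiniteDimensional ℝ Q]
    (hQ : ∀ u ∈ Q, ContDiff ℝ 1 u ∧ tsupport u ⊆ Ioo (0:ℝ) 2) :
    BddAbove (range fun u : {u : Q // (u : ℝ → ℝ) ≠ 0} => rayleigh1d V ((u : Q) : ℝ → ℝ)) := by
  let b := Module.finBasis ℝ Q
  let U : (Fin (Module.finrank ℝ Q) → ℝ) → ℝ → ℝ := fun c => (b.equivFun.symm c : Q)
  have hUm : ∀ c, U c ∈ Q := fun c => (b.equivFun.symm c).2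
  have hU : ∀ c x, U c x = ∑ i, c i * (b i : ℝ → ℝ) x := fun c x => by
    simp [U, Module.Basis.equivFun_symm_apply, Finset.sum_apply]
  have hUd : ∀ c x, deriv (U c) x = ∑ i, c i * deriv (b i : ℝ → ℝ) x := fun c x => by
    rw [funext (hU c)]
    exact (HasDerivAt.fun_sum fun i _ =>
      (((hQ _ (b i).2).1.differentiable one_ne_zero x).hasDerivAt.const_mul (c i))).deriv
  have hUne : ∀ c, c ≠ 0 → U c ≠ 0 := fun c hc h => hc (by
    have : b.equivFun.symm c = 0 := Subtype.ext h
    exact (LinearEquiv.map_eq_zero_iff _).1 this)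
  have hcb : ∀ i, Continuous (b i : ℝ → ℝ) := fun i => (hQ _ (b i).2).1.continuous
  have hcd : ∀ i, Continuous (deriv (b i : ℝ → ℝ)) :=
    fun i => (hQ _ (b i).2).1.continuous_deriv le_rfl
  have hcont : ∀ f : Fin (Module.finrank ℝ Q) → ℝ → ℝ, (∀ i, Continuous (f i)) → ∀ p q : ℝ,
      Continuous fun c : Fin (Module.finrank ℝ Q) → ℝ => ∫ x in p..q, (∑ i, c i * f i x) ^ 2 := by
    intro f hf p q
    refine intervalIntegral.continuous_parametric_intervalIntegral_of_continuous' ?_ p q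
    have := fun i => (hf i).comp
      (continuous_snd (X := Fin (Module.finrank ℝ Q) → ℝ) (Y := ℝ))
    simp only [Function.comp_def] at this
    unfold Function.uncurry
    fun_prop
  have hRc : ContinuousOn (fun c => rayleigh1d V (U c)) (Metric.sphere 0 1) := by
    simp only [rayleigh1d_eq, hU, hUd]
    refine ContinuousOn.div ?_ (hcont _ hcb _ _).continuousOn fun c hc => ?_
    · exact ((hcont _ hcd _ _).add ((hcont _ hcb _ _).const_mul V)).continuousOn
    · have hc0 : c ≠ 0 := Metric.ne_of_mem_sphere hc one_ne_zero
      have := sq_integral_pos (hQ _ (hUm c)).1.continuous (hQ _ (hUm c)).2 (hUne c hc0)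
      simp only [hU] at this
      exact this.ne'
  obtain ⟨M, hM⟩ := (isCompact_sphere (0 : Fin (Module.finrank ℝ Q) → ℝ) 1).bddAbove_image hRc
  refine ⟨M, ?_⟩
  rintro _ ⟨⟨u, hu⟩, rfl⟩
  set c := b.equivFun u with hc
  have hc0 : c ≠ 0 := fun h => hu (by
    have : u = 0 := by simpa [hc] using h
    simp [this])
  have hcn : ‖c‖⁻¹ ≠ 0 := inv_ne_zero (norm_ne_zero_iff.2 hc0)
  have hUc : U (‖c‖⁻¹ • c) = ‖c‖⁻¹ • (u : ℝ → ℝ) := by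
    simp only [U, map_smul, hc, LinearEquiv.symm_apply_apply, Submodule.coe_smul]
  have := hM ⟨‖c‖⁻¹ • c, by simp [norm_smul, norm_ne_zero_iff.2 hc0], rfl⟩
  simpa only [hUc, rayleigh1d_smul V hcn] using this

theorem exists_mem_forall_node_eq_zero (Q : Submodule ℝ (ℝ → ℝ)) {k : ℕ} (hk : 1 ≤ k)
    (hQk : Module.finrank ℝ Q = k) (hQ : ∀ u ∈ Q, tsupport u ⊆ Ioo (0:ℝ) 2) :
    ∃ u ∈ Q, u ≠ 0 ∧ ∀ j < k, u ((j : ℝ) / k) = 0 := by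
  have : FiniteDimensional ℝ Q := Module.finite_of_finrank_pos (by omega)
  let L : Q →ₗ[ℝ] (Fin (k - 1) → ℝ) :=
    LinearMap.pi fun j => (LinearMap.proj (((j : ℕ) + 1 : ℕ) / k : ℝ)).comp Q.subtype
  have hL : LinearMap.ker L ≠ ⊥ := LinearMap.ker_ne_bot_of_finrank_lt (by simp; omega)
  obtain ⟨u, hu, hne⟩ := Submodule.exists_mem_ne_zero_of_ne_bot hL
  refine ⟨u, u.2, fun h => hne (Subtype.ext h), fun j hj => ?_⟩
  cases j with
  | zero => exact image_eq_zero_of_notMem_tsupport fun h => by simpa using (hQ _ u.2 h).1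
  | succ j => exact congrFun (LinearMap.mem_ker.1 hu) ⟨j, by omega⟩

theorem rayleigh1d_nonneg {V : ℝ} (hV : 0 ≤ V) (u : ℝ → ℝ) : 0 ≤ rayleigh1d V u := by
  have h : ∀ (f : ℝ → ℝ) (s : Set ℝ), 0 ≤ ∫ x in s, f x ^ 2 :=
    fun f s => integral_nonneg fun x => sq_nonneg _
  have h1 := h (deriv u) (Ioo 0 2)
  have h2 := h u (Ioo 1 2)
  have h3 := h u (Ioo 0 2)
  exact div_nonneg (by positivity) h3

theorem lamWell_le {k : ℕ} (hk : 1 ≤ k) {V : ℝ} (hV : 0 ≤ V) :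
    lamWell V k ≤ π ^ 2 * (k : ℝ) ^ 2 := by
  have hp : 0 < π ^ 2 * (k : ℝ) ^ 2 := by
    have : (0:ℝ) < k := by exact_mod_cast hk
    positivity
  refine le_of_forall_pos_le_add fun ε hε => ?_
  obtain ⟨Q, hQ, hR⟩ := exists_subspace_rayleigh1d_le hk (div_pos hε hp)
  have hbdd : BddBelow (range fun Q : {Q : Submodule ℝ (ℝ → ℝ) //
      Module.finrank ℝ Q = k ∧ ∀ u ∈ Q, ContDiff ℝ 1 u ∧ tsupport u ⊆ Ioo (0:ℝ) 2} =>
      ⨆ u : {u : (Q : Submodule ℝ (ℝ → ℝ)) // (u : ℝ → ℝ) ≠ 0},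
        rayleigh1d V ((u : (Q : Submodule ℝ (ℝ → ℝ))) : ℝ → ℝ)) :=
    ⟨0, by rintro _ ⟨Q, rfl⟩; exact Real.iSup_nonneg fun u => rayleigh1d_nonneg hV _⟩
  refine (ciInf_le hbdd ⟨Q, hQ⟩).trans ?_
  refine Real.iSup_le (fun u => ?_) (by positivity)
  refine (hR _ u.1.2 u.2 V).trans_eq ?_
  field_simp

theorem le_lamWell {k : ℕ} (hk : 1 ≤ k) {V : ℝ} (hV : (8 * k * π) ^ 2 ≤ V) :
    π ^ 2 * (k : ℝ) ^ 2 - 8 * k ^ 3 * π ^ 2 / √V ≤ lamWell V k := by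
  obtain ⟨Q₀, hQ₀, -⟩ := exists_subspace_rayleigh1d_le hk one_pos
  have : Nonempty {Q : Submodule ℝ (ℝ → ℝ) //
      Module.finrank ℝ Q = k ∧ ∀ u ∈ Q, ContDiff ℝ 1 u ∧ tsupport u ⊆ Ioo (0:ℝ) 2} := ⟨⟨Q₀, hQ₀⟩⟩
  refine le_ciInf fun ⟨Q, hQk, hQ⟩ => ?_
  have : FiniteDimensional ℝ Q := Module.finite_of_finrank_pos (by omega)
  obtain ⟨u, hu, hne, hz⟩ := exists_mem_forall_node_eq_zero Q hk hQk fun u hu => (hQ u hu).2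
  exact (le_rayleigh1d (hQ u hu).1 (hQ u hu).2 hne hk hz hV).trans
    (le_ciSup (bddAbove_rayleigh1d V Q hQ) ⟨⟨u, hu⟩, hne⟩)

/-- `|λ_k(V₀) − π²k²| ≤ C/√V₀` for large `V₀`. -/
theorem lamWell_rate (k : ℕ) (hk : 1 ≤ k) :
    ∃ C > 0, ∃ V₁ : ℝ, ∀ V₀ ≥ V₁,
      |lamWell V₀ k - π ^ 2 * (k : ℝ) ^ 2| ≤ C / Real.sqrt V₀ := by
  have hk0 : (0:ℝ) < k := by exact_mod_cast hk
  refine ⟨8 * k ^ 3 * π ^ 2, by positivity, (8 * k * π) ^ 2, fun V hV => ?_⟩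
  have h1 := lamWell_le hk (le_trans (sq_nonneg _) hV)
  have h2 := le_lamWell hk hV
  have h3 : 0 ≤ 8 * k ^ 3 * π ^ 2 / √V := by positivity
  exact abs_le.2 ⟨by linarith, by linarith⟩
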